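/- arXiv:cond-mat/0509649 — 2 statements merged into one kernel-verified Lean document; each statement's English description precedes it below -/
import Mathlib

section
/- With the noisy harmonic oscillator setup (γ, ω, σ, σ̄₁, σ̄₂ > 0; F = [[0,1],[−ω²,−γ]]; Σ = [[0,0],[0,σ]]; Q₀ = diag(σ̄₁², σ̄₂²); R(t) = ∫₀ᵗ e^{sF} Σ Σᵀ e^{sFᵀ} ds; Q(t) = e^{tF} Q₀ e^{tFᵀ} + R(t); σ_* = σ²/(2γω²)), the derivative of t ↦ det Q(t) at t = 0 equals (d/dt det Q)(0) = −2γ σ̄₁² (σ̄₂² − ω² σ_*). Consequently, the Gibbs entropy H_G(t) = 1 + log(2π) + (1/2) log det Q(t) of the Gaussian solution of the Fokker–Planck equation satisfies (dH_G/dt)(0) = −γ(σ̄₂² − ω²σ_*)/σ̄₂², which is negative when σ̄₂² > ω²σ_* and positive when σ̄₂² < ω²σ_*. -/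
open MeasureTheory Real Filter Matrix Set

section MatrixExponential

attribute [local instance] Matrix.linftyOpNormedRing Matrix.linftyOpNormedAlgebra

variable {n : Type*} [Fintype n] [DecidableEq n]

/-- The entries of `exp (t • A)` are differentiable in `t`, with derivative `exp (t • A) * A`. -/
theorem Matrix.hasDerivAt_exp_smul_apply (A : Matrix n n ℝ) (t : ℝ) (i j : n) :
    HasDerivAt (fun s : ℝ => NormedSpace.exp (s • A) i j) ((NormedSpace.exp (t • A) * A) i j) t :=
  hasDerivAt_pi.1 (hasDerivAt_pi.1 (hasDerivAt_exp_smul_const (𝕂 := ℝ) A t) i) j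

end MatrixExponential

section Congruence

variable {n : Type*} [Fintype n] [DecidableEq n]

/-- The entries of `exp (t • A) * C * exp (t • B)` are continuous in `t`. -/
theorem Matrix.continuous_exp_smul_mul_mul_exp_smul_apply (A B C : Matrix n n ℝ) (i j : n) :
    Continuous (fun t : ℝ => (NormedSpace.exp (t • A) * C * NormedSpace.exp (t • B)) i j) := by
  have hexp (D : Matrix n n ℝ) (k l : n) :
      Continuous (fun t : ℝ => NormedSpace.exp (t • D) k l) :=
    continuous_iff_continuousAt.2 fun t => (D.hasDerivAt_exp_smul_apply t k l).continuousAt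
  simp only [Matrix.mul_apply]
  exact continuous_finsetSum _ fun k _ =>
    (continuous_finsetSum _ fun l _ => (hexp A i l).mul continuous_const).mul (hexp B k j)

/-- The derivative at `0` of the entries of `exp (t • A) * C * exp (t • B)`. -/
theorem Matrix.hasDerivAt_exp_smul_mul_mul_exp_smul_apply_zero (A B C : Matrix n n ℝ) (i j : n) :
    HasDerivAt (fun t : ℝ => (NormedSpace.exp (t • A) * C * NormedSpace.exp (t • B)) i j)
      ((A * C + C * B) i j) 0 := by
  have hexp (D : Matrix n n ℝ) (k l : n) :
      HasDerivAt (fun t : ℝ => NormedSpace.exp (t • D) k l) (D k l) 0 := by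
    simpa using D.hasDerivAt_exp_smul_apply 0 k l
  have h := HasDerivAt.fun_sum (u := Finset.univ) fun k _ =>
    (HasDerivAt.fun_sum (u := Finset.univ) fun l _ => (hexp A i l).mul_const (C l k)).mul
      (hexp B k j)
  simp only [← Matrix.mul_apply, zero_smul, NormedSpace.exp_zero, Matrix.one_mul,
    Finset.sum_add_distrib] at h
  simpa [Matrix.mul_apply, Matrix.one_apply] using h

/-- The derivative at `0` of the entries of the covariance
`exp (t • A) * C * exp (t • B) + ∫ s in 0..t, exp (s • A) * D * exp (s • B)`. -/
theorem Matrix.hasDerivAt_exp_smul_mul_mul_exp_smul_add_integral_zero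
    (A B C D : Matrix n n ℝ) (i j : n) :
    HasDerivAt (fun t : ℝ => (NormedSpace.exp (t • A) * C * NormedSpace.exp (t • B)) i j +
        ∫ s in (0 : ℝ)..t, (NormedSpace.exp (s • A) * D * NormedSpace.exp (s • B)) i j)
      ((A * C + C * B + D) i j) 0 := by
  have hint :=
    (Matrix.continuous_exp_smul_mul_mul_exp_smul_apply A B D i j).integral_hasStrictDerivAt 0 0
  have h := (Matrix.hasDerivAt_exp_smul_mul_mul_exp_smul_apply_zero A B C i j).fun_add
    hint.hasDerivAt
  simpa only [zero_smul, NormedSpace.exp_zero, Matrix.one_mul, Matrix.mul_one,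
    ← Matrix.add_apply] using h

end Congruence

/-- Initial rate of change of the Gibbs entropy for the noisy harmonic oscillator:
`(d/dt det Q)(0) = -2γ σ̄₁² (σ̄₂² - ω² σ_*)` and
`(dH_G/dt)(0) = -γ(σ̄₂² - ω²σ_*)/σ̄₂²`, negative when `σ̄₂² > ω²σ_*` and positive when
`σ̄₂² < ω²σ_*`. -/
theorem noisy_ho_gibbs_initial_derivative (γ ω σ σ₁ σ₂ : ℝ)
    (hγ : 0 < γ) (hω : 0 < ω) (hσ : 0 < σ) (hσ₁ : 0 < σ₁) (hσ₂ : 0 < σ₂) :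
    ∀ F Sg Q₀ : Matrix (Fin 2) (Fin 2) ℝ,
      F = !![0, 1; -ω ^ 2, -γ] → Sg = !![0, 0; 0, σ] → Q₀ = !![σ₁ ^ 2, 0; 0, σ₂ ^ 2] →
    ∀ R : ℝ → Matrix (Fin 2) (Fin 2) ℝ,
      R = (fun t => Matrix.of (fun i j =>
        ∫ s in (0 : ℝ)..t,
          (NormedSpace.exp (s • F) * (Sg * Sgᵀ) * NormedSpace.exp (s • Fᵀ)) i j)) →
    ∀ Q : ℝ → Matrix (Fin 2) (Fin 2) ℝ,
      Q = (fun t => NormedSpace.exp (t • F) * Q₀ * NormedSpace.exp (t • Fᵀ) + R t) →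
    ∀ sstar : ℝ, sstar = σ ^ 2 / (2 * γ * ω ^ 2) →
    ∀ HG : ℝ → ℝ, HG = (fun t => 1 + Real.log (2 * Real.pi) + (1 / 2) * Real.log (Q t).det) →
      deriv (fun t => (Q t).det) 0 = -2 * γ * σ₁ ^ 2 * (σ₂ ^ 2 - ω ^ 2 * sstar) ∧
        deriv HG 0 = -γ * (σ₂ ^ 2 - ω ^ 2 * sstar) / σ₂ ^ 2 ∧
        (ω ^ 2 * sstar < σ₂ ^ 2 → deriv HG 0 < 0) ∧
        (σ₂ ^ 2 < ω ^ 2 * sstar → 0 < deriv HG 0) := by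
  rintro F Sg Q₀ hF hSg hQ₀ R rfl Q hQ sstar rfl HG rfl
  have hQderiv (i j : Fin 2) :
      HasDerivAt (fun t => Q t i j) ((F * Q₀ + Q₀ * Fᵀ + Sg * Sgᵀ) i j) 0 := by
    subst hQ
    exact Matrix.hasDerivAt_exp_smul_mul_mul_exp_smul_add_integral_zero F Fᵀ Q₀ (Sg * Sgᵀ) i j
  have hQzero : Q 0 = Q₀ := by
    subst hQ
    ext i j
    simp
  have hdet : HasDerivAt (fun t => (Q t).det)
      (-2 * γ * σ₁ ^ 2 * (σ₂ ^ 2 - ω ^ 2 * (σ ^ 2 / (2 * γ * ω ^ 2)))) 0 := by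
    simp only [Matrix.det_fin_two]
    refine (((hQderiv 0 0).fun_mul (hQderiv 1 1)).fun_sub
      ((hQderiv 0 1).fun_mul (hQderiv 1 0))).congr_deriv ?_
    simp only [hQzero, Matrix.add_apply, Matrix.mul_apply, Fin.sum_univ_two, Matrix.transpose_apply]
    simp [hF, hSg, hQ₀]
    field_simp
    ring
  have hdetzero : (Q 0).det = σ₁ ^ 2 * σ₂ ^ 2 := by
    simp [hQzero, hQ₀, Matrix.det_fin_two]
  have hHG : deriv (fun t => 1 + Real.log (2 * Real.pi) + (1 / 2) * Real.log (Q t).det) 0 =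
      -γ * (σ₂ ^ 2 - ω ^ 2 * (σ ^ 2 / (2 * γ * ω ^ 2))) / σ₂ ^ 2 := by
    have hne : (Q 0).det ≠ 0 := by
      rw [hdetzero]
      positivity
    rw [(((hdet.log hne).const_mul (1 / 2)).const_add _).deriv, hdetzero]
    field_simp
  refine ⟨hdet.deriv, hHG, fun h => ?_, fun h => ?_⟩
  · rw [hHG]
    exact div_neg_of_neg_of_pos (mul_neg_of_neg_of_pos (neg_neg_of_pos hγ) (sub_pos.2 h))
      (by positivity)
  · rw [hHG]
    exact div_pos (mul_pos_of_neg_of_neg (neg_neg_of_pos hγ) (sub_neg.2 h)) (by positivity)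
end

section
/- With the noisy harmonic oscillator setup (γ, ω, σ, σ̄₁, σ̄₂ > 0; F = [[0,1],[−ω²,−γ]]; Σ = [[0,0],[0,σ]]; Q₀ = diag(σ̄₁², σ̄₂²); R(t) = ∫₀ᵗ e^{sF} Σ Σᵀ e^{sFᵀ} ds; Q(t) = e^{tF} Q₀ e^{tFᵀ} + R(t); σ_* = σ²/(2γω²)), assume the underdamped condition γ² < 4ω² and that σ̄₁² < σ_* while σ̄₂² > ω² σ_*. Then the Gibbs entropy approaches its limit in an oscillatory manner: the derivative of t ↦ det Q(t) changes sign infinitely often; i.e., for every T > 0 there exist t₁, t₂ > T with (d/dt det Q)(t₁) > 0 and (d/dt det Q)(t₂) < 0. -/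
open MeasureTheory Real Filter Matrix Set

/-- The exponentially damped cosine `e^{-γt/2} cos (βt)`. -/
noncomputable def dampedCos (γ β t : ℝ) : ℝ := Real.exp (-(γ / 2) * t) * Real.cos (β * t)

/-- The exponentially damped sine `e^{-γt/2} sin (βt) / β`. -/
noncomputable def dampedSin (γ β t : ℝ) : ℝ := Real.exp (-(γ / 2) * t) * Real.sin (β * t) / β

lemma hasDerivAt_dampedCos (γ β t : ℝ) :
    HasDerivAt (dampedCos γ β) (-(γ / 2) * dampedCos γ β t - β ^ 2 * dampedSin γ β t) t := by
  have he := ((hasDerivAt_id t).const_mul (-(γ / 2))).exp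
  have hc := ((hasDerivAt_id t).const_mul β).cos
  refine (he.mul hc).congr_deriv ?_
  simp only [dampedCos, dampedSin, id]
  field_simp
  ring

lemma hasDerivAt_dampedSin (γ : ℝ) {β : ℝ} (hβ : β ≠ 0) (t : ℝ) :
    HasDerivAt (dampedSin γ β) (-(γ / 2) * dampedSin γ β t + dampedCos γ β t) t := by
  have he := ((hasDerivAt_id t).const_mul (-(γ / 2))).exp
  have hs := ((hasDerivAt_id t).const_mul β).sin
  refine ((he.mul hs).div_const β).congr_deriv ?_
  simp only [dampedCos, dampedSin, id]
  field_simp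

lemma dampedCos_sq_add_dampedSin_sq (γ : ℝ) {β : ℝ} (hβ : β ≠ 0) (t : ℝ) :
    dampedCos γ β t ^ 2 + β ^ 2 * dampedSin γ β t ^ 2 = Real.exp (-γ * t) := by
  have he : Real.exp (-γ * t) = Real.exp (-(γ / 2) * t) ^ 2 := by
    rw [← Real.exp_nat_mul]
    congr 1
    push_cast
    ring
  have hcs := Real.sin_sq_add_cos_sq (β * t)
  rw [he, dampedCos, dampedSin]
  rw [mul_comm β t] at *
  field_simp
  linear_combination hcs

/-- Closed form of the propagator of the underdamped harmonic oscillator. -/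
lemma exp_smul_underdamped {γ ω β : ℝ} (hβ : β ≠ 0) (hβω : β ^ 2 = ω ^ 2 - γ ^ 2 / 4) (t : ℝ) :
    NormedSpace.exp (t • !![0, 1; -ω ^ 2, -γ] : Matrix (Fin 2) (Fin 2) ℝ) =
      !![dampedCos γ β t + γ / 2 * dampedSin γ β t, dampedSin γ β t;
        -ω ^ 2 * dampedSin γ β t, dampedCos γ β t - γ / 2 * dampedSin γ β t] := by
  let J : Matrix (Fin 2) (Fin 2) ℝ := !![γ / 2 / β, 1 / β; -ω ^ 2 / β, -(γ / 2) / β]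
  have hJ : J * J = -1 := by
    have hω : ω ^ 2 = β ^ 2 + γ ^ 2 / 4 := by linarith
    ext i j
    fin_cases i <;> fin_cases j <;>
      simp [J, Matrix.mul_apply, Fin.sum_univ_two] <;> field_simp <;> grind
  let f : ℂ →ₐ[ℝ] Matrix (Fin 2) (Fin 2) ℝ := Complex.lift ⟨J, hJ⟩
  have hfz (z : ℂ) : f z = z.re • (1 : Matrix (Fin 2) (Fin 2) ℝ) + z.im • J := by
    simp [f, Complex.lift_apply, Complex.liftAux_apply, Algebra.algebraMap_eq_smul_one]
  have hf : Continuous f := f.toLinearMap.continuous_of_finiteDimensional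
  let z : ℂ := ⟨-(γ / 2) * t, β * t⟩
  have hz : (t • !![0, 1; -ω ^ 2, -γ] : Matrix (Fin 2) (Fin 2) ℝ) = f z := by
    rw [hfz]
    ext i j
    fin_cases i <;> fin_cases j <;> simp [J, z] <;> field_simp <;> ring
  have hexp : NormedSpace.exp (f z) = f (NormedSpace.exp z) := by
    open scoped Norms.Operator in exact (NormedSpace.map_exp f hf z).symm
  rw [hz, hexp, ← Complex.exp_eq_exp_ℂ, hfz, Complex.exp_re, Complex.exp_im]
  ext i j
  fin_cases i <;> fin_cases j <;> simp [J, z, dampedCos, dampedSin] <;> field_simp <;> ring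

/-- The accumulated noise covariance is `R_* - e^{tF} R_* e^{tFᵀ}`, where
`R_* = s diag(1, ω²)` is the stationary covariance. -/
lemma integral_noise_covariance {γ ω β σ s : ℝ} (hβ : β ≠ 0)
    (hβω : β ^ 2 = ω ^ 2 - γ ^ 2 / 4) (hs : σ ^ 2 = 2 * γ * ω ^ 2 * s) (t : ℝ) :
    (∫ r in (0 : ℝ)..t, dampedSin γ β r * (σ * σ) * dampedSin γ β r) =
        s * (1 - (dampedCos γ β t + γ / 2 * dampedSin γ β t) ^ 2
          - ω ^ 2 * dampedSin γ β t ^ 2) ∧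
      (∫ r in (0 : ℝ)..t, dampedSin γ β r * (σ * σ) *
          (dampedCos γ β r - γ / 2 * dampedSin γ β r)) =
        s * (γ * ω ^ 2 * dampedSin γ β t ^ 2) ∧
      (∫ r in (0 : ℝ)..t, (dampedCos γ β r - γ / 2 * dampedSin γ β r) * (σ * σ) *
          (dampedCos γ β r - γ / 2 * dampedSin γ β r)) =
        s * (ω ^ 2 - ω ^ 4 * dampedSin γ β t ^ 2
          - ω ^ 2 * (dampedCos γ β t - γ / 2 * dampedSin γ β t) ^ 2) := by
  have hω : ω ^ 2 = β ^ 2 + γ ^ 2 / 4 := by linarith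
  have hω4 : ω ^ 4 = (β ^ 2 + γ ^ 2 / 4) ^ 2 := by rw [← hω]; ring
  have hσ : σ * σ = 2 * γ * (β ^ 2 + γ ^ 2 / 4) * s := by rw [← hω, ← hs]; ring
  have hk := hasDerivAt_dampedCos γ β
  have hq := hasDerivAt_dampedSin γ hβ
  have hkc : Continuous (dampedCos γ β) :=
    continuous_iff_continuousAt.2 fun r => (hk r).continuousAt
  have hqc : Continuous (dampedSin γ β) :=
    continuous_iff_continuousAt.2 fun r => (hq r).continuousAt
  have hk0 : dampedCos γ β 0 = 1 := by simp [dampedCos]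
  have hq0 : dampedSin γ β 0 = 0 := by simp [dampedSin]
  have hp (r : ℝ) := (hk r).add ((hq r).const_mul (γ / 2))
  have hv (r : ℝ) := (hk r).sub ((hq r).const_mul (γ / 2))
  rw [hω, hω4, hσ]
  refine ⟨?_, ?_, ?_⟩
  · rw [intervalIntegral.integral_eq_sub_of_hasDerivAt
      (f := fun r => s * (1 - (dampedCos γ β r + γ / 2 * dampedSin γ β r) ^ 2
          - (β ^ 2 + γ ^ 2 / 4) * dampedSin γ β r ^ 2))
      (fun r _ => ?_) (Continuous.intervalIntegrable (by fun_prop) _ _)]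
    · simp [hk0, hq0]
    · refine (((((hp r).pow 2).const_sub 1).sub
        (((hq r).pow 2).const_mul (β ^ 2 + γ ^ 2 / 4))).const_mul s).congr_deriv ?_
      simp
      ring
  · rw [intervalIntegral.integral_eq_sub_of_hasDerivAt
      (f := fun r => s * (γ * (β ^ 2 + γ ^ 2 / 4) * dampedSin γ β r ^ 2))
      (fun r _ => ?_) (Continuous.intervalIntegrable (by fun_prop) _ _)]
    · simp [hq0]
    · refine ((((hq r).pow 2).const_mul (γ * (β ^ 2 + γ ^ 2 / 4))).const_mul s).congr_deriv ?_
      simp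
      ring
  · rw [intervalIntegral.integral_eq_sub_of_hasDerivAt
      (f := fun r => s * (β ^ 2 + γ ^ 2 / 4 - (β ^ 2 + γ ^ 2 / 4) ^ 2 * dampedSin γ β r ^ 2
          - (β ^ 2 + γ ^ 2 / 4) * (dampedCos γ β r - γ / 2 * dampedSin γ β r) ^ 2))
      (fun r _ => ?_) (Continuous.intervalIntegrable (by fun_prop) _ _)]
    · simp [hk0, hq0]
    · refine ((((((hq r).pow 2).const_mul ((β ^ 2 + γ ^ 2 / 4) ^ 2)).const_sub
        (β ^ 2 + γ ^ 2 / 4)).sub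
          (((hv r).pow 2).const_mul (β ^ 2 + γ ^ 2 / 4))).const_mul s).congr_deriv ?_
      simp
      ring

/-- Derivative of the determinant of the covariance, in closed form. -/
lemma hasDerivAt_det_covariance {γ ω β : ℝ} (hβ : β ≠ 0) (hβω : β ^ 2 = ω ^ 2 - γ ^ 2 / 4)
    (s a b t : ℝ) :
    HasDerivAt (fun t => s ^ 2 * ω ^ 2
        + s * (ω ^ 2 * (b * dampedSin γ β t ^ 2
              - a * (dampedCos γ β t + γ / 2 * dampedSin γ β t) ^ 2)
            + (b * (dampedCos γ β t - γ / 2 * dampedSin γ β t) ^ 2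
              - a * (ω ^ 2 * dampedSin γ β t) ^ 2))
        - a * b * Real.exp (-γ * t) ^ 2)
      (2 * γ * (a * b * Real.exp (-γ * t) ^ 2
        - s * (b * (dampedCos γ β t - γ / 2 * dampedSin γ β t) ^ 2
          - a * (ω ^ 2 * dampedSin γ β t) ^ 2))) t := by
  have hω : ω ^ 2 = β ^ 2 + γ ^ 2 / 4 := by linarith
  have hk := hasDerivAt_dampedCos γ β t
  have hq := hasDerivAt_dampedSin γ hβ t
  have hp := hk.add (hq.const_mul (γ / 2))
  have hv := hk.sub (hq.const_mul (γ / 2))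
  have he := ((hasDerivAt_id t).const_mul (-γ)).exp
  refine ((((((hq.pow 2).const_mul b).sub ((hp.pow 2).const_mul a)).const_mul (ω ^ 2)).add
    (((hv.pow 2).const_mul b).sub
      (((hq.const_mul (ω ^ 2)).pow 2).const_mul a))).const_mul s
    |>.const_add (s ^ 2 * ω ^ 2) |>.sub ((he.pow 2).const_mul (a * b))).congr_deriv ?_
  simp
  rw [hω]
  ring

/-- Underdamped noisy harmonic oscillator (`γ² < 4ω²`) with `σ̄₁² < σ_*` and
`σ̄₂² > ω²σ_*`: the Gibbs entropy approaches its limit in an oscillatory manner; the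
derivative of `t ↦ det Q(t)` changes sign infinitely often. -/
theorem noisy_ho_underdamped_gibbs_oscillatory (γ ω σ σ₁ σ₂ : ℝ)
    (hγ : 0 < γ) (hω : 0 < ω) (hσ : 0 < σ) (hσ₁ : 0 < σ₁) (hσ₂ : 0 < σ₂)
    (hunder : γ ^ 2 < 4 * ω ^ 2) :
    ∀ F Sg Q₀ : Matrix (Fin 2) (Fin 2) ℝ,
      F = !![0, 1; -ω ^ 2, -γ] → Sg = !![0, 0; 0, σ] → Q₀ = !![σ₁ ^ 2, 0; 0, σ₂ ^ 2] →
    ∀ R : ℝ → Matrix (Fin 2) (Fin 2) ℝ,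
      R = (fun t => Matrix.of (fun i j =>
        ∫ s in (0 : ℝ)..t,
          (NormedSpace.exp (s • F) * (Sg * Sgᵀ) * NormedSpace.exp (s • Fᵀ)) i j)) →
    ∀ Q : ℝ → Matrix (Fin 2) (Fin 2) ℝ,
      Q = (fun t => NormedSpace.exp (t • F) * Q₀ * NormedSpace.exp (t • Fᵀ) + R t) →
    ∀ sstar : ℝ, sstar = σ ^ 2 / (2 * γ * ω ^ 2) →
    σ₁ ^ 2 < sstar → σ₂ ^ 2 > ω ^ 2 * sstar →
      ∀ T : ℝ, 0 < T → ∃ t₁ t₂ : ℝ, T < t₁ ∧ T < t₂ ∧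
        0 < deriv (fun t => (Q t).det) t₁ ∧ deriv (fun t => (Q t).det) t₂ < 0 := by
  rintro F Sg Q₀ hF hSg hQ₀ R hR Q hQ s hs h₁ h₂ T hT
  obtain ⟨β, hβ, hβω⟩ : ∃ β : ℝ, 0 < β ∧ β ^ 2 = ω ^ 2 - γ ^ 2 / 4 :=
    ⟨√(ω ^ 2 - γ ^ 2 / 4), Real.sqrt_pos.2 (by linarith), Real.sq_sqrt (by linarith)⟩
  have hβ' := hβ.ne'
  have hσs : σ ^ 2 = 2 * γ * ω ^ 2 * s := by
    rw [hs]
    field_simp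
  have hs0 : 0 < s := by rw [hs]; positivity
  obtain ⟨a, ha⟩ : ∃ a, a = s - σ₁ ^ 2 := ⟨_, rfl⟩
  obtain ⟨b, hb⟩ : ∃ b, b = σ₂ ^ 2 - ω ^ 2 * s := ⟨_, rfl⟩
  have ha0 : 0 < a := by linarith
  have hb0 : 0 < b := by linarith
  have has : a < s := by linarith [pow_pos hσ₁ 2]
  have hdet : (fun t => (Q t).det) = fun t => s ^ 2 * ω ^ 2
        + s * (ω ^ 2 * (b * dampedSin γ β t ^ 2
              - a * (dampedCos γ β t + γ / 2 * dampedSin γ β t) ^ 2)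
            + (b * (dampedCos γ β t - γ / 2 * dampedSin γ β t) ^ 2
              - a * (ω ^ 2 * dampedSin γ β t) ^ 2))
        - a * b * Real.exp (-γ * t) ^ 2 := by
    funext t
    obtain ⟨h11, h12, h22⟩ := integral_noise_covariance hβ' hβω hσs t
    have h21 : (∫ r in (0 : ℝ)..t, (dampedCos γ β r - γ / 2 * dampedSin γ β r) * (σ * σ) *
        dampedSin γ β r) = s * (γ * ω ^ 2 * dampedSin γ β t ^ 2) := by
      rw [← h12]
      congr 1
      funext r
      ring
    have hE (r : ℝ) : NormedSpace.exp (r • Fᵀ) = (NormedSpace.exp (r • F))ᵀ := by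
      rw [← Matrix.exp_transpose, Matrix.transpose_smul]
    have hσ₁' : σ₁ ^ 2 = s - a := by linarith
    have hσ₂' : σ₂ ^ 2 = b + ω ^ 2 * s := by linarith
    rw [← dampedCos_sq_add_dampedSin_sq γ hβ' t, hβω]
    simp only [hQ, hR, hE]
    simp only [hF, exp_smul_underdamped hβ' hβω, hSg, hQ₀, Matrix.det_fin_two]
    simp [Matrix.mul_apply, Matrix.vecMul, dotProduct, Fin.sum_univ_two, h11, h12, h21, h22, hσ₁', hσ₂']
    ring
  have hderiv (t : ℝ) := (hasDerivAt_det_covariance hβ' hβω s a b t).deriv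
  rw [hdet]
  obtain ⟨n, hn⟩ := exists_nat_gt (T * β / (2 * π))
  have hn' : T * β < n * (2 * π) := (div_lt_iff₀ (by positivity)).1 hn
  have hθ : 0 < Real.arctan (2 * β / γ) := Real.arctan_pos.2 (by positivity)
  refine ⟨(Real.arctan (2 * β / γ) + n * (2 * π)) / β, n * (2 * π) / β,
    (lt_div_iff₀ hβ).2 (by linarith), (lt_div_iff₀ hβ).2 hn', ?_, ?_⟩
  · rw [hderiv]
    set t := (Real.arctan (2 * β / γ) + n * (2 * π)) / β with ht
    have hβt : β * t = Real.arctan (2 * β / γ) + n * (2 * π) := by rw [ht]; field_simp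
    have hzero : dampedCos γ β t - γ / 2 * dampedSin γ β t = 0 := by
      have htan := Real.tan_mul_cos (Real.cos_arctan_pos (2 * β / γ)).ne'
      rw [Real.tan_arctan] at htan
      rw [dampedCos, dampedSin, hβt, Real.sin_add_nat_mul_two_pi, Real.cos_add_nat_mul_two_pi,
        ← htan]
      field_simp
      ring
    rw [hzero]
    have hpos : 0 < a * b * Real.exp (-γ * t) ^ 2 := by positivity
    have hnn : 0 ≤ s * (a * (ω ^ 2 * dampedSin γ β t) ^ 2) := by positivity
    exact mul_pos (by positivity) (by linarith)
  · rw [hderiv]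
    set t := n * (2 * π) / β with ht
    have ht0 : 0 < t := hT.trans ((lt_div_iff₀ hβ).2 hn')
    have hβt : β * t = n * (2 * π) := by rw [ht]; field_simp
    have hq : dampedSin γ β t = 0 := by
      have := Real.sin_add_nat_mul_two_pi 0 n
      rw [zero_add, Real.sin_zero] at this
      simp [dampedSin, hβt, this]
    have hk := dampedCos_sq_add_dampedSin_sq γ hβ' t
    rw [hq] at hk ⊢
    have hw : Real.exp (-γ * t) < 1 := Real.exp_lt_one_iff.2 (by nlinarith)
    have hw0 := Real.exp_pos (-γ * t)
    have haw : a * Real.exp (-γ * t) < s := by nlinarith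
    have hneg := mul_neg_of_pos_of_neg (mul_pos hb0 hw0) (sub_neg.2 haw)
    refine mul_neg_of_pos_of_neg (by positivity) ?_
    linear_combination hneg - s * b * hk
end
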